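/- arXiv:1802.02397 — 5 statements merged into one kernel-verified Lean document; each statement's English description precedes it below -/
import Mathlib

section
/- Let n ≥ 1 and let C : Fin n → Fin n → ℝ be a reciprocal PC matrix with all entries positive (C i j * C j i = 1 for all i, j). Define the geometric-mean priority vector w by w i = (∏_{r} C i r)^{1/n} (real power). Then for all i, j one has C i j * w j / w i = (∏_{k} C i j * C j k * C k i)^{1/n}. -/
open Finset

/-- The local error index `ε(i,j) = C i j * w j / w i` for a real PC matrix. -/
noncomputable def localErrorR {n : ℕ} (C : Fin n → Fin n → ℝ) (w : Fin n → ℝ) (i j : Fin n) : ℝ :=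
  C i j * w j / w i

/-- The global error index `𝓔(C,w) = max_{i,j} max(ε(i,j), ε(i,j)⁻¹)` for a real PC matrix. -/
noncomputable def globalErrorR {n : ℕ} (hn : 1 ≤ n) (C : Fin n → Fin n → ℝ) (w : Fin n → ℝ) : ℝ :=
  Finset.sup' (Finset.univ : Finset (Fin n × Fin n))
    (by haveI : Nonempty (Fin n) := ⟨⟨0, hn⟩⟩; exact Finset.univ_nonempty)
    (fun p => max (localErrorR C w p.1 p.2) (localErrorR C w p.1 p.2)⁻¹)

/-- The generalized inconsistency index
`GI(C) = max_{i,j,k} max(t(i,j,k), t(i,j,k)⁻¹)` where `t(i,j,k) = C i j * C j k * C k i`. -/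
noncomputable def genInconsistencyR {n : ℕ} (hn : 1 ≤ n) (C : Fin n → Fin n → ℝ) : ℝ :=
  Finset.sup' (Finset.univ : Finset (Fin n × Fin n × Fin n))
    (by haveI : Nonempty (Fin n) := ⟨⟨0, hn⟩⟩; exact Finset.univ_nonempty)
    (fun p => max (C p.1 p.2.1 * C p.2.1 p.2.2 * C p.2.2 p.1)
                  (C p.1 p.2.1 * C p.2.1 p.2.2 * C p.2.2 p.1)⁻¹)

/-- Koczkodaj's inconsistency index
`KI(C) = max_{i,j,k} (1 - min(C i j / (C i k * C k j), (C i k * C k j) / C i j))`. -/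
noncomputable def koczkodaj {n : ℕ} (hn : 1 ≤ n) (C : Fin n → Fin n → ℝ) : ℝ :=
  Finset.sup' (Finset.univ : Finset (Fin n × Fin n × Fin n))
    (by haveI : Nonempty (Fin n) := ⟨⟨0, hn⟩⟩; exact Finset.univ_nonempty)
    (fun p => 1 - min (C p.1 p.2.1 / (C p.1 p.2.2 * C p.2.2 p.2.1))
                      ((C p.1 p.2.2 * C p.2.2 p.2.1) / C p.1 p.2.1))

/-- The geometric-mean (GMM) priority vector `w i = (∏ r, C i r) ^ (1/n)` (real power). -/
noncomputable def gmWeight {n : ℕ} (C : Fin n → Fin n → ℝ) (i : Fin n) : ℝ :=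
  (∏ r, C i r) ^ ((1 : ℝ) / n)

/-- For a positive reciprocal real PC matrix `C` with GMM priority vector
`w i = (∏ r, C i r) ^ (1/n)`, one has
`C i j * w j / w i = (∏ k, C i j * C j k * C k i) ^ (1/n)` for all `i, j`. -/
theorem gmm_local_error_eq {n : ℕ} (hn : 1 ≤ n) (C : Fin n → Fin n → ℝ)
    (hpos : ∀ i j, 0 < C i j) (hrec : ∀ i j, C i j * C j i = 1) :
    ∀ i j, C i j * gmWeight C j / gmWeight C i =
      (∏ k, C i j * C j k * C k i) ^ ((1 : ℝ) / n) := by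
  intro i j
  have hn0 : (n : ℝ) ≠ 0 := Nat.cast_ne_zero.mpr (by omega)
  have hprod (a : Fin n) : 0 < ∏ r, C a r := Finset.prod_pos fun r _ => hpos a r
  have hinv : ∏ k, C k i = (∏ k, C i k)⁻¹ := by
    rw [← Finset.prod_inv_distrib]
    exact Finset.prod_congr rfl fun k _ => eq_inv_of_mul_eq_one_left (hrec k i)
  have hpow : (C i j ^ n) ^ ((1 : ℝ) / n) = C i j := by
    rw [← Real.rpow_natCast, ← Real.rpow_mul (hpos i j).le, mul_one_div_cancel hn0, Real.rpow_one]
  have hCn : 0 ≤ C i j ^ n := pow_nonneg (hpos i j).le n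
  rw [Finset.prod_mul_distrib, Finset.prod_mul_distrib, hinv, Finset.prod_const,
    Finset.card_univ, Fintype.card_fin,
    Real.mul_rpow (mul_nonneg hCn (hprod j).le) (inv_nonneg.mpr (hprod i).le),
    Real.mul_rpow hCn (hprod j).le, hpow, Real.inv_rpow (hprod i).le, gmWeight, gmWeight,
    div_eq_mul_inv]
end

section
/- Let n ≥ 1 and let C : Fin n → Fin n → ℝ be a reciprocal PC matrix with all entries positive (C i j * C j i = 1 for all i, j). Define the geometric-mean priority vector w by w i = (∏_{r} C i r)^{1/n}. Then the global error index is bounded by the generalized inconsistency index: 𝓔(C,w) ≤ GI(C), where GI(C) = max over all i, j, k of max(t(i,j,k), t(i,j,k)⁻¹) with t(i,j,k) = C i j * C j k * C k i, and 𝓔(C,w) = max over all i, j of max(ε(i,j), ε(i,j)⁻¹) with ε(i,j) = C i j * w j / w i. -/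
open Finset

/-- Passing to the transposed pair inverts the local error of a reciprocal matrix. -/
theorem localErrorR_inv {n : ℕ} (C : Fin n → Fin n → ℝ) (w : Fin n → ℝ)
    (hrec : ∀ i j, C i j * C j i = 1) (i j : Fin n) :
    (localErrorR C w i j)⁻¹ = localErrorR C w j i := by
  have h : (C i j)⁻¹ = C j i := inv_eq_of_mul_eq_one_right (hrec i j)
  simp only [localErrorR, inv_div, ← h]
  rw [div_eq_mul_inv, div_eq_mul_inv, mul_inv]
  ring

theorem gmWeight_pow {n : ℕ} (hn : 1 ≤ n) (C : Fin n → Fin n → ℝ)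
    (hpos : ∀ i j, 0 < C i j) (i : Fin n) : gmWeight C i ^ n = ∏ r, C i r := by
  rw [gmWeight, one_div, Real.rpow_inv_natCast_pow (Finset.prod_nonneg fun r _ => (hpos i r).le)
    (by omega)]

/-- The `n`-th power of a local error for the geometric-mean weights is the product of the
triad errors through the pair. -/
theorem localErrorR_gmWeight_pow {n : ℕ} (hn : 1 ≤ n) (C : Fin n → Fin n → ℝ)
    (hpos : ∀ i j, 0 < C i j) (hrec : ∀ i j, C i j * C j i = 1) (i j : Fin n) :
    localErrorR C (gmWeight C) i j ^ n = ∏ r, C i j * C j r * C r i := by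
  have h : ∏ r, C r i = (∏ r, C i r)⁻¹ := by
    rw [← Finset.prod_inv_distrib]
    exact Finset.prod_congr rfl fun r _ => eq_inv_of_mul_eq_one_left (hrec r i)
  simp [localErrorR, mul_pow, gmWeight_pow hn C hpos, Finset.prod_mul_distrib, h,
    div_eq_mul_inv]

theorem localErrorR_gmWeight_le {n : ℕ} (hn : 1 ≤ n) (C : Fin n → Fin n → ℝ)
    (hpos : ∀ i j, 0 < C i j) (hrec : ∀ i j, C i j * C j i = 1) (i j : Fin n) :
    localErrorR C (gmWeight C) i j ≤ genInconsistencyR hn C := by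
  have ht (r : Fin n) : C i j * C j r * C r i ≤ genInconsistencyR hn C :=
    (le_max_left _ _).trans (Finset.le_sup' (fun p : Fin n × Fin n × Fin n =>
      max (C p.1 p.2.1 * C p.2.1 p.2.2 * C p.2.2 p.1)
        (C p.1 p.2.1 * C p.2.1 p.2.2 * C p.2.2 p.1)⁻¹) (Finset.mem_univ (i, j, r)))
  have ht0 (r : Fin n) : 0 < C i j * C j r * C r i :=
    mul_pos (mul_pos (hpos i j) (hpos j r)) (hpos r i)
  refine le_of_pow_le_pow_left₀ (by omega : n ≠ 0) ((ht0 i).le.trans (ht i)) ?_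
  rw [localErrorR_gmWeight_pow hn C hpos hrec]
  calc ∏ r, C i j * C j r * C r i ≤ ∏ _r : Fin n, genInconsistencyR hn C :=
        Finset.prod_le_prod (fun r _ => (ht0 r).le) fun r _ => ht r
    _ = genInconsistencyR hn C ^ n := by simp

/-- For a positive reciprocal real PC matrix `C` with GMM priority vector
`w`, the global error index is bounded by the generalized inconsistency index:
`𝓔(C,w) ≤ GI(C)`. -/
theorem gmm_globalError_le_genInconsistency {n : ℕ} (hn : 1 ≤ n) (C : Fin n → Fin n → ℝ)
    (hpos : ∀ i j, 0 < C i j) (hrec : ∀ i j, C i j * C j i = 1) :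
    globalErrorR hn C (gmWeight C) ≤ genInconsistencyR hn C := by
  refine Finset.sup'_le _ _ fun p _ => max_le (localErrorR_gmWeight_le hn C hpos hrec _ _) ?_
  rw [localErrorR_inv C _ hrec]
  exact localErrorR_gmWeight_le hn C hpos hrec _ _
end

section
/- Let n ≥ 1 and let C : Fin n → Fin n → ℝ be a reciprocal PC matrix with all entries positive (C i j * C j i = 1 for all i, j). Then the generalized inconsistency index and the Koczkodaj inconsistency index satisfy GI(C) = 1 / (1 - KI(C)), where GI(C) = max over all i, j, k of max(t(i,j,k), t(i,j,k)⁻¹) with t(i,j,k) = C i j * C j k * C k i, and KI(C) = max over all i, j, k of (1 - min(C i j / (C i k * C k j), (C i k * C k j) / C i j)). -/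
open Finset

/-- For a reciprocal matrix, the deviation of `C i j` from `C i k * C k j` is a product over
a triad. -/
theorem div_mul_eq_triad {ι : Type*} {C : ι → ι → ℝ}
    (hrec : ∀ i j, C i j * C j i = 1) (i j k : ι) :
    C i j / (C i k * C k j) = C i j * C j k * C k i := by
  rw [div_eq_mul_inv, mul_inv, ← eq_inv_of_mul_eq_one_right (hrec i k),
    ← eq_inv_of_mul_eq_one_right (hrec k j)]
  ring

/-- The minimum of `t` and `t⁻¹` is the inverse of their maximum. -/
theorem min_self_inv_eq_inv_max (t : ℝ) : min t t⁻¹ = (max t t⁻¹)⁻¹ := by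
  rcases le_total t t⁻¹ with h | h
  · rw [min_eq_left h, max_eq_right h, inv_inv]
  · rw [min_eq_right h, max_eq_left h]

/-- The maximum of `1 - (f p)⁻¹` is attained where the positive function `f` is maximal. -/
theorem sup'_one_sub_inv {α : Type*} {s : Finset α} (hs : s.Nonempty) {f : α → ℝ}
    (hf : ∀ p ∈ s, 0 < f p) :
    s.sup' hs (fun p => 1 - (f p)⁻¹) = 1 - (s.sup' hs f)⁻¹ := by
  apply le_antisymm
  · refine Finset.sup'_le _ _ fun p hp => sub_le_sub_left ?_ 1
    exact inv_anti₀ (hf p hp) (Finset.le_sup' f hp)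
  · obtain ⟨p, hp, h⟩ := Finset.exists_mem_eq_sup' hs f
    rw [h]
    exact Finset.le_sup' (fun p => 1 - (f p)⁻¹) hp

/-- Koczkodaj's index of a positive reciprocal matrix in terms of the generalized index. -/
theorem koczkodaj_eq_one_sub_inv_genInconsistencyR {n : ℕ} (hn : 1 ≤ n)
    (C : Fin n → Fin n → ℝ) (hpos : ∀ i j, 0 < C i j)
    (hrec : ∀ i j, C i j * C j i = 1) :
    koczkodaj hn C = 1 - (genInconsistencyR hn C)⁻¹ := by
  have ht : ∀ i j k, 0 < C i j * C j k * C k i := fun i j k =>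
    mul_pos (mul_pos (hpos i j) (hpos j k)) (hpos k i)
  unfold koczkodaj genInconsistencyR
  rw [← sup'_one_sub_inv _ fun p _ => lt_max_of_lt_left (ht p.1 p.2.1 p.2.2)]
  refine Finset.sup'_congr _ rfl fun p _ => ?_
  rw [← min_self_inv_eq_inv_max, ← div_mul_eq_triad hrec, inv_div]

/-- For a positive reciprocal real PC matrix `C`, the generalized
inconsistency index and the Koczkodaj inconsistency index satisfy
`GI(C) = 1 / (1 - KI(C))`. -/
theorem genInconsistency_eq_inv_one_sub_koczkodaj {n : ℕ} (hn : 1 ≤ n)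
    (C : Fin n → Fin n → ℝ) (hpos : ∀ i j, 0 < C i j)
    (hrec : ∀ i j, C i j * C j i = 1) :
    genInconsistencyR hn C = 1 / (1 - koczkodaj hn C) := by
  rw [koczkodaj_eq_one_sub_inv_genInconsistencyR hn C hpos hrec, sub_sub_cancel, one_div, inv_inv]
end

section
/- Let n ≥ 1 and let C : Fin n → Fin n → ℝ be a reciprocal PC matrix with all entries positive (C i j * C j i = 1 for all i, j). Define the geometric-mean priority vector w by w i = (∏_{r} C i r)^{1/n}. If for some indices i, j one has C i j > 1 / (1 - KI(C)), where KI(C) = max over all i, j, k of (1 - min(C i j / (C i k * C k j), (C i k * C k j) / C i j)), then w i > w j. -/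
open Finset

/-- Koczkodaj's index of a positive PC matrix is less than `1`. -/
theorem koczkodaj_lt_one {n : ℕ} (hn : 1 ≤ n) (C : Fin n → Fin n → ℝ)
    (hpos : ∀ i j, 0 < C i j) : koczkodaj hn C < 1 := by
  refine (Finset.sup'_lt_iff _).2 fun p _ => sub_lt_self _ (lt_min ?_ ?_)
  · exact div_pos (hpos _ _) (mul_pos (hpos _ _) (hpos _ _))
  · exact div_pos (mul_pos (hpos _ _) (hpos _ _)) (hpos _ _)

/-- Koczkodaj's index bounds the relative error of every triad from below. -/
theorem one_sub_koczkodaj_le {n : ℕ} (hn : 1 ≤ n) (C : Fin n → Fin n → ℝ) (i j k : Fin n) :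
    1 - koczkodaj hn C ≤ C i k * C k j / C i j := by
  have h : 1 - min (C i j / (C i k * C k j)) (C i k * C k j / C i j) ≤ koczkodaj hn C :=
    Finset.le_sup' (fun p : Fin n × Fin n × Fin n =>
      1 - min (C p.1 p.2.1 / (C p.1 p.2.2 * C p.2.2 p.2.1))
        ((C p.1 p.2.2 * C p.2.2 p.2.1) / C p.1 p.2.1)) (Finset.mem_univ (i, j, k))
  linarith [min_le_right (C i j / (C i k * C k j)) (C i k * C k j / C i j)]

/-- Strict row dominance is reflected by the geometric-mean weights. -/
theorem gmWeight_lt_gmWeight {n : ℕ} (hn : 1 ≤ n) (C : Fin n → Fin n → ℝ)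
    (hpos : ∀ i j, 0 < C i j) {i j : Fin n} (h : ∀ r, C j r < C i r) :
    gmWeight C j < gmWeight C i := by
  refine Real.rpow_lt_rpow (Finset.prod_nonneg fun r _ => (hpos j r).le) ?_
    (one_div_pos.2 (Nat.cast_pos.2 hn))
  exact Finset.prod_lt_prod_of_nonempty (fun r _ => hpos j r) (fun r _ => h r)
    ⟨i, Finset.mem_univ i⟩

/-- For a positive reciprocal real PC matrix `C` with GMM priority vector
`w`, if `C i j > 1 / (1 - KI(C))` for some `i, j`, then `w i > w j`. -/
theorem pop_of_gt_koczkodaj_bound {n : ℕ} (hn : 1 ≤ n) (C : Fin n → Fin n → ℝ)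
    (hpos : ∀ i j, 0 < C i j) (hrec : ∀ i j, C i j * C j i = 1)
    (i j : Fin n) (hij : 1 / (1 - koczkodaj hn C) < C i j) :
    gmWeight C j < gmWeight C i := by
  refine gmWeight_lt_gmWeight hn C hpos fun r => ?_
  have hone : 1 < C i j * (1 - koczkodaj hn C) :=
    (div_lt_iff₀ (sub_pos.2 (koczkodaj_lt_one hn C hpos))).1 hij
  have htriad : (1 - koczkodaj hn C) * C i j ≤ C i r * C r j :=
    (le_div_iff₀ (hpos i j)).1 (one_sub_koczkodaj_le hn C i j r)
  calc C j r = 1 * C j r := (one_mul _).symm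
    _ < C i r * C r j * C j r := mul_lt_mul_of_pos_right (by linarith) (hpos j r)
    _ = C i r := by rw [mul_assoc, hrec, mul_one]
end

section
/- Let n ≥ 1 and let C : Fin n → Fin n → ℝ be a reciprocal PC matrix with all entries positive (C i j * C j i = 1 for all i, j). Define the geometric-mean priority vector w by w i = (∏_{r} C i r)^{1/n}. Let KI(C) = max over all i, j, k of (1 - min(C i j / (C i k * C k j), (C i k * C k j) / C i j)). If for indices i, j, k, l one has C i j > 1 / (1 - KI(C)), C k l > 1 / (1 - KI(C)), and C i j / C k l > (1 / (1 - KI(C)))^2, then w i / w j > w k / w l (and also w i > w j and w k > w l). -/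
open Finset

theorem gmWeight_pos {n : ℕ} {C : Fin n → Fin n → ℝ} (hpos : ∀ i j, 0 < C i j) (i : Fin n) :
    0 < gmWeight C i :=
  Real.rpow_pos_of_pos (Finset.prod_pos fun r _ => hpos i r) _

theorem one_sub_koczkodaj_pos {n : ℕ} (hn : 1 ≤ n) {C : Fin n → Fin n → ℝ}
    (hpos : ∀ i j, 0 < C i j) : 0 < 1 - koczkodaj hn C := by
  rw [sub_pos, koczkodaj, Finset.sup'_lt_iff]
  rintro ⟨i, j, k⟩ -
  have hik := hpos i k
  have hkj := hpos k j
  have hij := hpos i j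
  exact sub_lt_self _ (lt_min (by positivity) (by positivity))

theorem one_sub_koczkodaj_mul_le {n : ℕ} (hn : 1 ≤ n) {C : Fin n → Fin n → ℝ}
    (hpos : ∀ i j, 0 < C i j) (i j k : Fin n) :
    (1 - koczkodaj hn C) * C i j ≤ C i k * C k j := by
  rw [← le_div_iff₀ (hpos i j), sub_le_comm]
  exact (sub_le_sub_left (min_le_right _ _) 1).trans
    (Finset.le_sup' (fun p : Fin n × Fin n × Fin n =>
      1 - min (C p.1 p.2.1 / (C p.1 p.2.2 * C p.2.2 p.2.1))
        ((C p.1 p.2.2 * C p.2.2 p.2.1) / C p.1 p.2.1)) (Finset.mem_univ (i, j, k)))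

/-- If every row entry of `C i` dominates `c` times that of `C j`, then so do the weights. -/
theorem mul_gmWeight_le {n : ℕ} (hn : 1 ≤ n) {C : Fin n → Fin n → ℝ}
    (hpos : ∀ i j, 0 < C i j) {c : ℝ} (hc : 0 ≤ c) {i j : Fin n}
    (h : ∀ r, c * C j r ≤ C i r) : c * gmWeight C j ≤ gmWeight C i := by
  have hj : ∀ r, 0 ≤ C j r := fun r => (hpos j r).le
  have hprod : c ^ n * ∏ r, C j r ≤ ∏ r, C i r := by
    calc c ^ n * ∏ r, C j r = ∏ r, c * C j r := by simp [Finset.prod_mul_distrib]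
      _ ≤ ∏ r, C i r := Finset.prod_le_prod (fun r _ => mul_nonneg hc (hj r)) fun r _ => h r
  have hP : 0 ≤ ∏ r, C j r := Finset.prod_nonneg fun r _ => hj r
  calc c * gmWeight C j = (c ^ n * ∏ r, C j r) ^ ((1 : ℝ) / n) := by
        rw [Real.mul_rpow (pow_nonneg hc n) hP, one_div,
          Real.pow_rpow_inv_natCast hc (by omega), gmWeight, one_div]
    _ ≤ gmWeight C i :=
        Real.rpow_le_rpow (mul_nonneg (pow_nonneg hc n) hP) hprod (by positivity)

/-- The weight ratio `w i / w j` is at least `(1 - KI(C)) * C i j`. -/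
theorem one_sub_koczkodaj_mul_le_gmWeight_div {n : ℕ} (hn : 1 ≤ n) {C : Fin n → Fin n → ℝ}
    (hpos : ∀ i j, 0 < C i j) (hrec : ∀ i j, C i j * C j i = 1) (i j : Fin n) :
    (1 - koczkodaj hn C) * C i j ≤ gmWeight C i / gmWeight C j := by
  rw [le_div_iff₀ (gmWeight_pos hpos j)]
  refine mul_gmWeight_le hn hpos
    (mul_nonneg (one_sub_koczkodaj_pos hn hpos).le (hpos i j).le) fun r => ?_
  calc (1 - koczkodaj hn C) * C i j * C j r ≤ C i r * C r j * C j r :=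
        mul_le_mul_of_nonneg_right (one_sub_koczkodaj_mul_le hn hpos i j r) (hpos j r).le
    _ = C i r := by rw [mul_assoc, hrec, mul_one]

/-- The weight ratio `w i / w j` is at most `C i j / (1 - KI(C))`. -/
theorem gmWeight_div_le_div_one_sub_koczkodaj {n : ℕ} (hn : 1 ≤ n) {C : Fin n → Fin n → ℝ}
    (hpos : ∀ i j, 0 < C i j) (hrec : ∀ i j, C i j * C j i = 1) (i j : Fin n) :
    gmWeight C i / gmWeight C j ≤ C i j / (1 - koczkodaj hn C) := by
  have hK := one_sub_koczkodaj_pos hn hpos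
  have h := inv_anti₀ (mul_pos hK (hpos j i))
    (one_sub_koczkodaj_mul_le_gmWeight_div hn hpos hrec j i)
  rwa [inv_div, mul_inv, inv_eq_of_mul_eq_one_left (hrec i j), mul_comm, ← div_eq_mul_inv] at h

/-- For a positive reciprocal real PC matrix `C` with GMM priority vector
`w`, if `C i j > 1 / (1 - KI(C))`, `C k l > 1 / (1 - KI(C))`, and
`C i j / C k l > (1 / (1 - KI(C)))^2`, then `w i / w j > w k / w l`
(and also `w i > w j` and `w k > w l`). -/
theorem poip_of_gt_koczkodaj_bound {n : ℕ} (hn : 1 ≤ n) (C : Fin n → Fin n → ℝ)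
    (hpos : ∀ i j, 0 < C i j) (hrec : ∀ i j, C i j * C j i = 1)
    (i j k l : Fin n)
    (hij : 1 / (1 - koczkodaj hn C) < C i j)
    (hkl : 1 / (1 - koczkodaj hn C) < C k l)
    (hratio : (1 / (1 - koczkodaj hn C)) ^ 2 < C i j / C k l) :
    gmWeight C k / gmWeight C l < gmWeight C i / gmWeight C j ∧
      gmWeight C j < gmWeight C i ∧ gmWeight C l < gmWeight C k := by
  have hK := one_sub_koczkodaj_pos hn hpos
  have key : ∀ a b, 1 / (1 - koczkodaj hn C) < C a b → gmWeight C b < gmWeight C a := by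
    intro a b hab
    rw [← one_lt_div (gmWeight_pos hpos b)]
    exact ((div_lt_iff₀' hK).1 hab).trans_le
      (one_sub_koczkodaj_mul_le_gmWeight_div hn hpos hrec a b)
  refine ⟨?_, key i j hij, key k l hkl⟩
  refine (gmWeight_div_le_div_one_sub_koczkodaj hn hpos hrec k l).trans_lt
    (lt_of_lt_of_le ?_ (one_sub_koczkodaj_mul_le_gmWeight_div hn hpos hrec i j))
  rw [one_div_pow, div_lt_div_iff₀ (pow_pos hK 2) (hpos k l)] at hratio
  rw [div_lt_iff₀ hK]
  linarith
end
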